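/- arXiv:1004.1376 — 2 statements merged into one kernel-verified Lean document; each statement's English description precedes it below -/
import Mathlib

section
/- Define a product ∘ on the ℂ-vector space (⊕_{[ρ]∈Ĝ} End(V_ρ)) ⊗ ℂQ, spanned by elements (x_ρ, q) with x_ρ ∈ End(V_ρ) and q ∈ Q, by (x_{ρ₁},q₁)∘(x'_{ρ₂},q₂) := (x_{ρ₁}·(T_{q₁}^{[ρ₁]})⁻¹·x'_{q₁([ρ₁])}·T_{q₁}^{[ρ₁]}·ρ₁(τ(q₁,q₂)), q₁q₂) if [ρ₂] = q₁([ρ₁]) and 0 otherwise. Then ∘ is associative, and the map sending g·s(q) ∈ H (for g ∈ G, q ∈ Q) to ∑_{[ρ]∈Ĝ} (ρ(g), q) extends linearly to an isomorphism of ℂ-algebras from the group algebra ℂH onto the resulting twisted crossed product algebra ⊕_{[ρ]} End(V_ρ) ⋊_{T,τ} Q. -/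
noncomputable section

/-- A representation is irreducible if the space is nonzero and has no nontrivial invariant
subspace. -/
def IsIrredRep {K V : Type} [Group K] [AddCommGroup V] [Module ℂ V]
    (ρ : Representation ℂ K V) : Prop :=
  Nontrivial V ∧
    ∀ W : Submodule ℂ V, (∀ (k : K), ∀ v ∈ W, ρ k v ∈ W) → W = ⊥ ∨ W = ⊤

/-- Two representations are isomorphic if there is an intertwining linear equivalence. -/
def RepIso {K V W : Type} [Group K] [AddCommGroup V] [Module ℂ V]
    [AddCommGroup W] [Module ℂ W]
    (ρ : Representation ℂ K V) (σ : Representation ℂ K W) : Prop :=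
  ∃ e : V ≃ₗ[ℂ] W, ∀ (k : K) (v : V), e (ρ k v) = σ k (e v)

/-- The representation `g ↦ ρ (h·g·h⁻¹)` of the (normal) kernel of `j`, for `h : H`. -/
def conjRep {H Q : Type} [Group H] [Group Q] (j : H →* Q) {V : Type}
    [AddCommGroup V] [Module ℂ V] (ρ : Representation ℂ j.ker V) (h : H) :
    Representation ℂ j.ker V :=
  MonoidHom.comp ρ (MulAut.conjNormal h).toMonoidHom

/-- `τ(q₁,q₂) := s q₁ * s q₂ * (s (q₁ q₂))⁻¹`, an element of `G = ker j`. -/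
def tau {H Q : Type} [Group H] [Group Q] (j : H →* Q) (s : Q → H)
    (hs : ∀ q, j (s q) = q) (q₁ q₂ : Q) : j.ker :=
  ⟨s q₁ * s q₂ * (s (q₁ * q₂))⁻¹, by simp [MonoidHom.mem_ker, hs, mul_assoc]⟩

/-- Transport along an equality of indices, as a linear map. -/
def castHom {Ghat : Type} (V : Ghat → Type) [∀ r, AddCommGroup (V r)]
    [∀ r, Module ℂ (V r)] {a b : Ghat} (h : a = b) : V a →ₗ[ℂ] V b where
  toFun v := cast (congrArg V h) v
  map_add' := by subst h; intros; rfl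
  map_smul' := by subst h; intros; rfl

variable {H Q : Type} [Group H] [Group Q] [Fintype Q]

/-- The twisted crossed product multiplication on `⊕_{[ρ]∈Ĝ} End(V_ρ) ⊗ ℂQ` (encoded as
functions `Q → Π r, End (V r)`), determined on the spanning elements `(x_ρ, q)` by
`(x_{ρ₁},q₁)∘(x'_{ρ₂},q₂) = (x_{ρ₁}·(T_{q₁}^{[ρ₁]})⁻¹·x'_{q₁([ρ₁])}·T_{q₁}^{[ρ₁]}·ρ₁(τ(q₁,q₂)),
q₁q₂)` when `[ρ₂] = q₁([ρ₁])`, and `0` otherwise. -/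
def twMulEnd (j : H →* Q) (s : Q → H) (hs : ∀ q, j (s q) = q)
    {Ghat : Type} (V : Ghat → Type) [∀ r, AddCommGroup (V r)] [∀ r, Module ℂ (V r)]
    (ρ : ∀ r, Representation ℂ j.ker (V r))
    (act : Q → Ghat → Ghat) (T : ∀ (q : Q) (r : Ghat), V r ≃ₗ[ℂ] V (act q r))
    (f₁ f₂ : ∀ _ : Q, ∀ r, Module.End ℂ (V r)) : ∀ _ : Q, ∀ r, Module.End ℂ (V r) :=
  fun q r => ∑ q₁ : Q,
    f₁ q₁ r ∘ₗ (T q₁ r).symm.toLinearMap ∘ₗ f₂ (q₁⁻¹ * q) (act q₁ r) ∘ₗ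
      (T q₁ r).toLinearMap ∘ₗ (ρ r (tau j s hs q₁ (q₁⁻¹ * q)) : V r →ₗ[ℂ] V r)

section Wedderburn

open scoped MonoidAlgebra

variable {K : Type} [Group K]

lemma RepIso.asAlgebraHom_apply {V W : Type} [AddCommGroup V] [Module ℂ V]
    [AddCommGroup W] [Module ℂ W] {ρ : Representation ℂ K V} {σ : Representation ℂ K W}
    {e : V ≃ₗ[ℂ] W} (he : ∀ (k : K) (v : V), e (ρ k v) = σ k (e v)) (a : ℂ[K]) (v : V) :
    e (ρ.asAlgebraHom a v) = σ.asAlgebraHom a (e v) := by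
  induction a using MonoidAlgebra.induction_linear with
  | zero => simp
  | add x y hx hy => simp [hx, hy]
  | single k c => simp [he]

lemma IsIrredRep.isSimpleModule {V : Type} [AddCommGroup V] [Module ℂ V]
    {ρ : Representation ℂ K V} (h : IsIrredRep ρ) : IsSimpleModule ℂ[K] ρ.asModule := by
  have : Nontrivial ρ.asModule := h.1
  rw [isSimpleModule_iff]
  refine ⟨fun S ↦ ?_⟩
  have hS := h.2 ((S.restrictScalars ℂ).map ρ.asModuleEquiv.toLinearMap) (by
    rintro k _ ⟨v, hv, rfl⟩
    refine ⟨MonoidAlgebra.of ℂ K k • v, S.smul_mem _ hv, ?_⟩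
    simp
    rfl)
  refine hS.imp (fun h ↦ ?_) (fun h ↦ ?_)
  · simpa using h
  · simpa using h

lemma isIrredRep_ofModule' (M : Type) [AddCommGroup M] [Module ℂ M] [Module ℂ[K] M]
    [IsScalarTower ℂ ℂ[K] M] [IsSimpleModule ℂ[K] M] :
    IsIrredRep (Representation.ofModule' (k := ℂ) (G := K) M) := by
  refine ⟨IsSimpleModule.nontrivial ℂ[K] M, fun W hW ↦ ?_⟩
  have hsmul (a : ℂ[K]) (v : M) (hv : v ∈ W) : a • v ∈ W := by
    induction a using MonoidAlgebra.induction_linear with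
    | zero => simp
    | add x y hx hy => rw [add_smul]; exact W.add_mem hx hy
    | single k c =>
      have h := W.smul_mem c (hW k v hv)
      rw [← mul_one c, ← smul_eq_mul, ← MonoidAlgebra.smul_single, smul_assoc]
      exact h
  let S : Submodule ℂ[K] M := { W with smul_mem' := fun a v hv ↦ hsmul a v hv }
  have hS : (S : Set M) = W := rfl
  refine (eq_bot_or_eq_top S).imp (fun h ↦ ?_) (fun h ↦ ?_)
  · exact SetLike.coe_injective (by rw [← hS, h]; rfl)
  · exact SetLike.coe_injective (by rw [← hS, h]; rfl)

variable {ι : Type} (V : ι → Type) [∀ r, AddCommGroup (V r)] [∀ r, Module ℂ (V r)]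
  (ρ : ∀ r, Representation ℂ K (V r))

/-- The action of the group algebra on a family of representations. -/
def groupAlgebraToPiEnd : ℂ[K] →ₗ[ℂ] ∀ r, Module.End ℂ (V r) :=
  LinearMap.pi fun r ↦ (ρ r).asAlgebraHom.toLinearMap

lemma groupAlgebraToPiEnd_apply (a : ℂ[K]) (r : ι) :
    groupAlgebraToPiEnd V ρ a r = (ρ r).asAlgebraHom a := rfl

/-- An element of the group algebra acting by zero on every irreducible representation is zero. -/
lemma groupAlgebraToPiEnd_injective [Finite K]
    (hcomplete : ∀ (W : Type) [AddCommGroup W] [Module ℂ W] [FiniteDimensional ℂ W]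
      (σ : Representation ℂ K W), IsIrredRep σ → ∃ r, RepIso σ (ρ r)) :
    Function.Injective (groupAlgebraToPiEnd V ρ) := by
  rw [injective_iff_map_eq_zero]
  intro a ha
  have hfin : FiniteDimensional ℂ ℂ[K] := .of_basis (MonoidAlgebra.basis K ℂ)
  have hzero (S : Submodule ℂ[K] ℂ[K]) (hS : IsSimpleModule ℂ[K] S) (v : S) : a • v = 0 := by
    have : FiniteDimensional ℂ S :=
      inferInstanceAs (FiniteDimensional ℂ (S.restrictScalars ℂ))
    obtain ⟨r, e, he⟩ := hcomplete S (Representation.ofModule' S) (isIrredRep_ofModule' S)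
    apply e.injective
    have h := RepIso.asAlgebraHom_apply he a v
    rw [← groupAlgebraToPiEnd_apply, ha] at h
    have hsmul : (Representation.ofModule' (k := ℂ) (G := K) S).asAlgebraHom a v = a • v := by
      simp [Representation.asAlgebraHom, Representation.ofModule']
    rw [← hsmul, h]
    simp
  have hmem : (1 : ℂ[K]) ∈ sSup {S : Submodule ℂ[K] ℂ[K] | IsSimpleModule ℂ[K] S} := by
    rw [IsSemisimpleModule.sSup_simples_eq_top]; trivial
  rw [sSup_eq_iSup'] at hmem
  suffices ∀ v ∈ ⨆ S : {S : Submodule ℂ[K] ℂ[K] | IsSimpleModule ℂ[K] S}, S.1, a * v = 0 by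
    simpa using this 1 hmem
  intro v hv
  induction hv using Submodule.iSup_induction' with
  | mem S v hv => exact congr(Subtype.val $(hzero S S.2 ⟨v, hv⟩))
  | zero => simp
  | add v w _ _ hv hw => rw [mul_add, hv, hw, add_zero]

/-- Burnside's theorem for a finite family of pairwise non-isomorphic irreducible
representations. -/
lemma groupAlgebraToPiEnd_surjective [Finite K] [Finite ι]
    [∀ r, FiniteDimensional ℂ (V r)]
    (hirr : ∀ r, IsIrredRep (ρ r)) (hdist : ∀ r r', RepIso (ρ r) (ρ r') → r = r') :
    Function.Surjective (groupAlgebraToPiEnd V ρ) := by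
  classical
  intro x
  have := Fintype.ofFinite ι
  have hsimple r := (hirr r).isSimpleModule
  have hoff {r r' : ι} (hr : r ≠ r') (f : (ρ r).asModule →ₗ[ℂ[K]] (ρ r').asModule) : f = 0 := by
    refine f.bijective_or_eq_zero.resolve_left fun hf ↦ hr (hdist r r' ?_)
    refine ⟨(LinearEquiv.ofBijective f hf).restrictScalars ℂ, fun k (v : (ρ r).asModule) ↦ ?_⟩
    have h := f.map_smul (MonoidAlgebra.of ℂ K k) v
    rw [MonoidAlgebra.of_apply, Representation.single_smul, Representation.single_smul,
      one_smul, one_smul] at h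
    exact h
  let M := ∀ r, (ρ r).asModule
  have hcomm (φ : Module.End ℂ[K] M) : ∃ c : ι → ℂ, ∀ m r, φ m r = c r • m r := by
    have hscalar (r : ι) := (IsSimpleModule.algebraMap_end_bijective_of_isAlgClosed
      (A := ℂ[K]) (V := (ρ r).asModule) ℂ).2
        (LinearMap.proj r ∘ₗ φ ∘ₗ LinearMap.single ℂ[K] (fun r ↦ (ρ r).asModule) r)
    choose c hc using hscalar
    refine ⟨c, fun m r ↦ ?_⟩
    conv_lhs => rw [← Finset.univ_sum_single m, map_sum, Finset.sum_apply]
    rw [Finset.sum_eq_single r]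
    · exact congr($(hc r) (m r)).symm
    · intro r' _ hr'
      exact congr($(hoff hr' (LinearMap.proj r ∘ₗ φ ∘ₗ
        LinearMap.single ℂ[K] (fun r ↦ (ρ r).asModule) r')) (m r'))
    · simp
  let y (r : ι) : Module.End ℂ (ρ r).asModule := x r
  let f : Module.End (Module.End ℂ[K] M) M :=
    { toFun := fun m r ↦ y r (m r)
      map_add' := fun m m' ↦ funext fun r ↦ (y r).map_add (m r) (m' r)
      map_smul' := fun φ m ↦ by
        obtain ⟨c, hc⟩ := hcomm φ
        ext r
        simp only [Module.End.smul_def, RingHom.id_apply, hc, map_smul] }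
  have : Module.Finite (Module.End ℂ[K] M) M := .of_restrictScalars_finite ℂ _ _
  obtain ⟨a, ha⟩ := Module.Finite.toModuleEnd_moduleEnd_surjective f
  refine ⟨a, funext fun r ↦ LinearMap.ext fun (v : (ρ r).asModule) ↦ ?_⟩
  have h := congr($ha (Pi.single r v : M) r)
  change (a • (Pi.single r v : M)) r = y r ((Pi.single r v : M) r) at h
  rw [Pi.smul_apply, Pi.single_eq_same] at h
  exact h

end Wedderburn

section Section

variable {A B : Type} [Group A] [Group B] (j : A →* B) (s : B → A) (hs : ∀ b, j (s b) = b)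

lemma mul_section_mul_mul_section (g g' : j.ker) (q q' : B) :
    (g * s q : A) * (g' * s q') =
      (g * MulAut.conjNormal (s q) g' * tau j s hs q q' : j.ker) * s (q * q') := by
  simp [tau, MulAut.conjNormal_apply, mul_assoc]

/-- The bijection `A ≃ B × ker j` inverse to `(q, g) ↦ g·s(q)`. -/
def sectionEquiv : A ≃ B × j.ker where
  toFun h := (j h, ⟨h * (s (j h))⁻¹, by simp [MonoidHom.mem_ker, hs]⟩)
  invFun x := x.2 * s x.1
  left_inv h := by simp
  right_inv x := by
    have h : j (x.2 * s x.1) = x.1 := by rw [map_mul, x.2.2, hs, one_mul]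
    refine Prod.ext h (Subtype.ext ?_)
    simp [h]

lemma exists_eq_mul_section (hs : ∀ b, j (s b) = b) (h : A) :
    ∃ (g : j.ker) (q : B), h = g * s q :=
  ⟨_, _, ((sectionEquiv j s hs).symm_apply_apply h).symm⟩

lemma sectionEquiv_mul_section (g : j.ker) (q : B) :
    sectionEquiv j s hs (g * s q) = (q, g) :=
  (sectionEquiv j s hs).apply_symm_apply (q, g)

/-- The decomposition of the group algebra of `A` as a sum of copies of that of `ker j`. -/
def groupAlgebraSectionEquiv [Finite B] : MonoidAlgebra ℂ A ≃ₗ[ℂ] (B → MonoidAlgebra ℂ j.ker) :=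
  MonoidAlgebra.coeffLinearEquiv ℂ ≪≫ₗ Finsupp.domLCongr (sectionEquiv j s hs) ≪≫ₗ
    Finsupp.curryLinearEquiv ℂ ≪≫ₗ Finsupp.linearEquivFunOnFinite ℂ _ B ≪≫ₗ
    LinearEquiv.piCongrRight fun _ ↦ (MonoidAlgebra.coeffLinearEquiv ℂ).symm

lemma groupAlgebraSectionEquiv_single [Finite B] [DecidableEq B] (g : j.ker) (q : B) (c : ℂ) :
    groupAlgebraSectionEquiv j s hs (MonoidAlgebra.single ((g : A) * s q) c) =
      Pi.single q (MonoidAlgebra.single g c) := by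
  ext q' g'
  simp [groupAlgebraSectionEquiv, sectionEquiv_mul_section, Pi.single_apply]
  split_ifs <;> simp

end Section

section CrossedProduct

variable (j : H →* Q) (s : Q → H) (hs : ∀ q, j (s q) = q)
  {Ghat : Type} (V : Ghat → Type) [∀ r, AddCommGroup (V r)] [∀ r, Module ℂ (V r)]
  (ρ : ∀ r, Representation ℂ j.ker (V r))
  (act : Q → Ghat → Ghat) (T : ∀ (q : Q) (r : Ghat), V r ≃ₗ[ℂ] V (act q r))

/-- The twisted crossed product multiplication as a bilinear map. -/
def twMulEndHom : (∀ _ : Q, ∀ r, Module.End ℂ (V r)) →ₗ[ℂ]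
    (∀ _ : Q, ∀ r, Module.End ℂ (V r)) →ₗ[ℂ] ∀ _ : Q, ∀ r, Module.End ℂ (V r) :=
  LinearMap.mk₂ ℂ (twMulEnd j s hs V ρ act T)
    (fun f f' g ↦ by
      ext q r v
      simp [twMulEnd, Finset.sum_add_distrib])
    (fun c f g ↦ by
      ext q r v
      simp [twMulEnd, Finset.smul_sum])
    (fun f g g' ↦ by
      ext q r v
      simp [twMulEnd, Finset.sum_add_distrib])
    (fun c f g ↦ by
      ext q r v
      simp [twMulEnd, Finset.smul_sum])

/-- The image of `g·s(q)` in the twisted crossed product. -/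
def twSingle [DecidableEq Q] (g : j.ker) (q : Q) : ∀ _ : Q, ∀ r, Module.End ℂ (V r) :=
  fun q' r => if q' = q then ρ r g else 0

variable {j s V ρ act T} in
lemma twMulEnd_twSingle [DecidableEq Q]
    (hT : ∀ (q : Q) (r : Ghat) (g : j.ker) (v : V r),
      T q r (conjRep j (ρ r) (s q) g v) = ρ (act q r) g (T q r v))
    (g g' : j.ker) (q q' : Q) :
    twMulEnd j s hs V ρ act T (twSingle j V ρ g q) (twSingle j V ρ g' q') =
      twSingle j V ρ (g * MulAut.conjNormal (s q) g' * tau j s hs q q') (q * q') := by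
  ext p r v
  rw [twMulEnd, LinearMap.sum_apply, Finset.sum_eq_single q]
  · by_cases hp : p = q * q'
    · subst hp
      simp only [twSingle, if_true, inv_mul_cancel_left, LinearMap.comp_apply,
        LinearEquiv.coe_coe, ← hT, LinearEquiv.symm_apply_apply, map_mul, Module.End.mul_apply]
      rfl
    · have : q⁻¹ * p ≠ q' := fun h ↦ hp (by rw [← h, mul_inv_cancel_left])
      simp [twSingle, hp, this]
  · intro q₁ _ h
    simp [twSingle, h]
  · simp

end CrossedProduct

/-- The product `∘` on `(⊕_{[ρ]∈Ĝ} End (V_ρ)) ⊗ ℂQ` determined by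
`(x_{ρ₁},q₁)∘(x'_{ρ₂},q₂) := (x_{ρ₁}·(T_{q₁}^{[ρ₁]})⁻¹·x'_{q₁([ρ₁])}·T_{q₁}^{[ρ₁]}·ρ₁(τ(q₁,q₂)),
q₁q₂)` if `[ρ₂] = q₁([ρ₁])` and `0` otherwise, is associative; and the map sending
`g·s(q) ∈ H` to `∑_{[ρ]∈Ĝ} (ρ(g), q)` extends linearly to an isomorphism of ℂ-algebras from
the group algebra `ℂH` onto the resulting twisted crossed product algebra
`⊕_{[ρ]} End(V_ρ) ⋊_{T,τ} Q`. -/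
theorem stmt6 [Fintype H] [DecidableEq Q]
    (j : H →* Q) (hj : Function.Surjective j)
    (s : Q → H) (hs : ∀ q, j (s q) = q) (hs1 : s 1 = 1)
    {Ghat : Type} [Fintype Ghat]
    (V : Ghat → Type) [∀ r, AddCommGroup (V r)] [∀ r, Module ℂ (V r)]
    [∀ r, FiniteDimensional ℂ (V r)]
    (ρ : ∀ r, Representation ℂ j.ker (V r))
    (hirr : ∀ r, IsIrredRep (ρ r))
    (hdist : ∀ r r', RepIso (ρ r) (ρ r') → r = r')
    (hcomplete : ∀ (W : Type) [AddCommGroup W] [Module ℂ W] [FiniteDimensional ℂ W]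
      (σ : Representation ℂ j.ker W), IsIrredRep σ → ∃ r, RepIso σ (ρ r))
    (act : Q → Ghat → Ghat)
    (hact : ∀ q r, RepIso (conjRep j (ρ r) (s q)) (ρ (act q r)))
    (hact1 : ∀ r, act 1 r = r)
    (hactmul : ∀ (q₁ q₂ : Q) (r : Ghat), act q₂ (act q₁ r) = act (q₁ * q₂) r)
    (T : ∀ (q : Q) (r : Ghat), V r ≃ₗ[ℂ] V (act q r))
    (hT : ∀ (q : Q) (r : Ghat) (g : j.ker) (v : V r),
      T q r (conjRep j (ρ r) (s q) g v) = ρ (act q r) g (T q r v))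
    (hT1 : ∀ (r : Ghat) (v : V r), T 1 r v = castHom V (hact1 r).symm v) :
    (∀ f₁ f₂ f₃ : ∀ _ : Q, ∀ r, Module.End ℂ (V r),
      twMulEnd j s hs V ρ act T (twMulEnd j s hs V ρ act T f₁ f₂) f₃ =
        twMulEnd j s hs V ρ act T f₁ (twMulEnd j s hs V ρ act T f₂ f₃)) ∧
    (∃ φ : MonoidAlgebra ℂ H ≃ₗ[ℂ] (∀ _ : Q, ∀ r, Module.End ℂ (V r)),
      (∀ (g : j.ker) (q : Q),
        φ (MonoidAlgebra.single ((g : H) * s q) (1 : ℂ)) =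
          fun q' r => if q' = q then (ρ r g : Module.End ℂ (V r)) else 0) ∧
      (∀ x y : MonoidAlgebra ℂ H,
        φ (x * y) = twMulEnd j s hs V ρ act T (φ x) (φ y))) := by
  classical
  have hbij : Function.Bijective (groupAlgebraToPiEnd V ρ) :=
    ⟨groupAlgebraToPiEnd_injective V ρ hcomplete, groupAlgebraToPiEnd_surjective V ρ hirr hdist⟩
  let φ : MonoidAlgebra ℂ H ≃ₗ[ℂ] (∀ _ : Q, ∀ r, Module.End ℂ (V r)) :=
    groupAlgebraSectionEquiv j s hs ≪≫ₗ
      LinearEquiv.piCongrRight fun _ ↦ LinearEquiv.ofBijective _ hbij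
  have hφ (g : j.ker) (q : Q) :
      φ (MonoidAlgebra.single ((g : H) * s q) (1 : ℂ)) = twSingle j V ρ g q := by
    ext q' r v
    simp only [φ, LinearEquiv.trans_apply, groupAlgebraSectionEquiv_single,
      LinearEquiv.piCongrRight_apply, LinearEquiv.ofBijective_apply, twSingle]
    by_cases h : q' = q
    · subst h
      simp [groupAlgebraToPiEnd_apply]
    · simp [h]
  have hmul (x y : MonoidAlgebra ℂ H) :
      φ (x * y) = twMulEnd j s hs V ρ act T (φ x) (φ y) := by
    have hbilin : (LinearMap.mul ℂ (MonoidAlgebra ℂ H)).compr₂ φ.toLinearMap =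
        (twMulEndHom j s hs V ρ act T).compl₁₂ φ.toLinearMap φ.toLinearMap := by
      refine LinearMap.ext_basis (MonoidAlgebra.basis H ℂ) (MonoidAlgebra.basis H ℂ) fun h h' ↦ ?_
      obtain ⟨g, q, rfl⟩ := exists_eq_mul_section j s hs h
      obtain ⟨g', q', rfl⟩ := exists_eq_mul_section j s hs h'
      simp only [MonoidAlgebra.basis_apply, LinearMap.compr₂_apply, LinearMap.compl₁₂_apply,
        LinearMap.mul_apply', LinearEquiv.coe_coe, MonoidAlgebra.single_mul_single, one_mul,
        mul_section_mul_mul_section j s hs, hφ]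
      exact (twMulEnd_twSingle hs hT g g' q q').symm
    exact congr($hbilin x y)
  refine ⟨fun f₁ f₂ f₃ ↦ ?_, φ, hφ, hmul⟩
  obtain ⟨x, rfl⟩ := φ.surjective f₁
  obtain ⟨y, rfl⟩ := φ.surjective f₂
  obtain ⟨z, rfl⟩ := φ.surjective f₃
  simp only [← hmul, mul_assoc]
end
end

section
/- Let O ⊆ Ĝ be an orbit of the Q-action on Ĝ, let C(O⋊Q, c) be the subalgebra of C(Ĝ⋊Q, c) spanned by the basis elements ([ρ],q) with [ρ] ∈ O, fix [ρ₀] ∈ O, and let Stab([ρ₀]) := {q ∈ Q : q([ρ₀]) = [ρ₀]}. Then the restriction c_{[ρ₀]}(q₁,q₂) := c^{[ρ₀]}(q₁,q₂) for q₁, q₂ ∈ Stab([ρ₀]) is a 2-cocycle on the group Stab([ρ₀]), and C(O⋊Q, c) is Morita equivalent to the twisted group algebra C(Stab([ρ₀]), c_{[ρ₀]}). -/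
noncomputable section

/-- Two ℂ-algebras are Morita equivalent if their categories of left modules are
ℂ-linearly equivalent. -/
def MoritaEquiv (A B : Type) [Ring A] [Ring B] [Algebra ℂ A] [Algebra ℂ B] : Prop :=
  ∃ e : ModuleCat.{0} A ≌ ModuleCat.{0} B, ∃ _h : e.functor.Additive, e.functor.Linear ℂ

/-- The stabilizer `Stab([ρ₀]) = {q ∈ Q : q([ρ₀]) = [ρ₀]}` as a subgroup of `Q`. -/
def stabSub {Ghat Q : Type} [Group Q] (act : Q → Ghat → Ghat)
    (hact1 : ∀ r, act 1 r = r)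
    (hactmul : ∀ (q₁ q₂ : Q) (r : Ghat), act q₂ (act q₁ r) = act (q₁ * q₂) r)
    (r₀ : Ghat) : Subgroup Q where
  carrier := {q | act q r₀ = r₀}
  one_mem' := hact1 r₀
  mul_mem' := by
    intro a b ha hb
    simp only [Set.mem_setOf_eq] at *
    rw [← hactmul, ha, hb]
  inv_mem' := by
    intro a ha
    simp only [Set.mem_setOf_eq] at *
    calc act a⁻¹ r₀ = act a⁻¹ (act a r₀) := by rw [ha]
      _ = act (a * a⁻¹) r₀ := hactmul a a⁻¹ r₀
      _ = r₀ := by rw [mul_inv_cancel]; exact hact1 r₀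

/-- The underlying ℂ-vector space of the orbit part `C(O⋊Q, c)` of the twisted groupoid
algebra: functions on `Ĝ × Q` supported on `O × Q`. -/
structure OrbAlg (Ghat Q : Type) (O : Set Ghat) where
  /-- the coefficient at the basis element `([ρ], q)` -/
  coef : Ghat → Q → ℂ
  supp : ∀ r, r ∉ O → ∀ q, coef r q = 0

/-- The underlying ℂ-vector space of the twisted group algebra `C(Stab([ρ₀]), c_{[ρ₀]})`:
functions on `Q` supported on the stabilizer of `[ρ₀]` (i.e. with basis `Stab([ρ₀])`). -/
structure StabAlg (Ghat Q : Type) (act : Q → Ghat → Ghat) (r₀ : Ghat) where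
  /-- the coefficient at the basis element `q ∈ Stab([ρ₀])` -/
  coef : Q → ℂ
  supp : ∀ q, act q r₀ ≠ r₀ → coef q = 0

/-- If `e = φ 1` cuts out the corner `B ≅ eAe` and `∑ i, v i * u i = 1` with `u i * v j = δᵢⱼ e`,
then matrices over `B` are isomorphic to `A`. -/
theorem nonempty_matrix_algEquiv {R A B ι : Type*} [CommRing R] [Ring A] [Ring B] [Algebra R A]
    [Algebra R B] [Fintype ι] [DecidableEq ι] (φ : B →ₗ[R] A) (hφ : Function.Injective φ)
    (hmul : ∀ x y, φ (x * y) = φ x * φ y)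
    (hrange : ∀ a, φ 1 * a = a → a * φ 1 = a → ∃ b, φ b = a)
    (u v : ι → A) (huv : ∀ i j, u i * v j = if i = j then φ 1 else 0)
    (hvu : ∑ i, v i * u i = 1) (hu : ∀ i, φ 1 * u i = u i) (hv : ∀ i, v i * φ 1 = v i) :
    Nonempty (Matrix ι ι B ≃ₐ[R] A) := by
  have h1l (x) : φ 1 * φ x = φ x := by rw [← hmul, one_mul]
  have h1r (x) : φ x * φ 1 = φ x := by rw [← hmul, mul_one]
  let L : Matrix ι ι B →ₗ[R] A :=
    { toFun M := ∑ i, ∑ j, v i * φ (M i j) * u j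
      map_add' M N := by
        simp [mul_add, add_mul, Finset.sum_add_distrib]
      map_smul' a M := by
        simp [Finset.smul_sum] }
  have hL (M) : L M = ∑ i, ∑ j, v i * φ (M i j) * u j := rfl
  have huL (M i) : u i * L M = ∑ j, φ (M i j) * u j := by
    simp only [hL, Finset.mul_sum]
    rw [Finset.sum_eq_single i]
    · simp only [← mul_assoc, huv, if_true, h1l]
    · intro k _ hk
      simp [← mul_assoc, huv, hk.symm]
    · simp
  have huLv (M i j) : u i * L M * v j = φ (M i j) := by
    rw [huL, Finset.sum_mul, Finset.sum_eq_single j]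
    · rw [mul_assoc, huv, if_pos rfl, h1r]
    · intro k _ hk
      simp [mul_assoc, huv, hk]
    · simp
  have hone : L 1 = 1 := by
    rw [hL, ← hvu]
    refine Finset.sum_congr rfl fun i _ => ?_
    rw [Finset.sum_eq_single i]
    · simp [hv]
    · intro k _ hk
      simp [Matrix.one_apply_ne hk.symm]
    · simp
  have hLmul (M N) : L (M * N) = L M * L N := by
    have : L M * L N = ∑ i, ∑ j, v i * φ (M i j) * (u j * L N) := by
      rw [hL M]
      simp only [Finset.sum_mul, mul_assoc]
    rw [this, hL]
    refine Finset.sum_congr rfl fun i _ => ?_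
    simp only [huL, Matrix.mul_apply, map_sum, hmul, Finset.mul_sum, Finset.sum_mul]
    rw [Finset.sum_comm]
    simp only [mul_assoc]
  refine ⟨AlgEquiv.ofBijective (AlgHom.ofLinearMap L hone hLmul) ⟨fun M N h => ?_, fun a => ?_⟩⟩
  · replace h : L M = L N := h
    ext i j
    exact hφ (by rw [← huLv, ← huLv, h])
  · have hex (i j) : ∃ b, φ b = u i * a * v j :=
      hrange _ (by rw [← mul_assoc, ← mul_assoc, hu]) (by rw [mul_assoc, hv])
    choose M hM using hex
    refine ⟨Matrix.of M, ?_⟩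
    change L _ = a
    calc L (Matrix.of M) = ∑ i, ∑ j, v i * u i * a * (v j * u j) := by
          simp only [hL, Matrix.of_apply, hM, mul_assoc]
      _ = a := by
          simp only [← Finset.mul_sum, ← Finset.sum_mul, hvu, mul_one, one_mul]

theorem IsMoritaEquivalent.moritaEquiv {A B : Type} [Ring A] [Ring B] [Algebra ℂ A] [Algebra ℂ B]
    (h : IsMoritaEquivalent ℂ A B) : MoritaEquiv A B := by
  obtain ⟨⟨e⟩⟩ := h
  exact ⟨e.eqv, inferInstance, e.linear⟩

section CastHom

variable {ι Q : Type} (V : ι → Type) [∀ r, AddCommGroup (V r)] [∀ r, Module ℂ (V r)]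

theorem castHom_trans {a b d : ι} (h : a = b) (h' : b = d) (v : V a) :
    castHom V h' (castHom V h v) = castHom V (h.trans h') v := by
  subst h h'; rfl

theorem castHom_ne_zero {a b : ι} (h : a = b) {v : V a} (hv : v ≠ 0) : castHom V h v ≠ 0 := by
  subst h; exact hv

theorem apply_castHom {act : Q → ι → ι} (T : ∀ (q : Q) (r : ι), V r ≃ₗ[ℂ] V (act q r)) (q : Q)
    {a b : ι} (h : a = b) (v : V a) :
    T q b (castHom V h v) = castHom V (congrArg (act q) h) (T q a v) := by
  subst h; rfl

theorem apply_eq_castHom {act : Q → ι → ι} (T : ∀ (q : Q) (r : ι), V r ≃ₗ[ℂ] V (act q r))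
    {q q' : Q} (h : q = q') (r : ι) (v : V r) :
    T q' r v = castHom V (congrArg (act · r) h) (T q r v) := by
  subst h; rfl

end CastHom

section Cocycle

variable {H Q : Type} [Group H] [Group Q]
  {j : H →* Q} {s : Q → H} {hs : ∀ q, j (s q) = q}
  {Ghat : Type} {V : Ghat → Type} [∀ r, AddCommGroup (V r)] [∀ r, Module ℂ (V r)]
  {ρ : ∀ r, Representation ℂ j.ker (V r)}
  {act : Q → Ghat → Ghat}
  (hact1 : ∀ r, act 1 r = r)
  (hactmul : ∀ (q₁ q₂ : Q) (r : Ghat), act q₂ (act q₁ r) = act (q₁ * q₂) r)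
  {T : ∀ (q : Q) (r : Ghat), V r ≃ₗ[ℂ] V (act q r)}
  {c : Ghat → Q → Q → ℂ}

theorem cocycle_ne_zero [∀ r, Nontrivial (V r)]
    (hcdef : ∀ (r : Ghat) (q₁ q₂ : Q) (v : V r),
      T q₂ (act q₁ r) (T q₁ r v) =
        c r q₁ q₂ • castHom V (hactmul q₁ q₂ r).symm
          (T (q₁ * q₂) r (ρ r ((tau j s hs q₁ q₂)⁻¹) v))) (r : Ghat) (q₁ q₂ : Q) :
    c r q₁ q₂ ≠ 0 := by
  intro h
  obtain ⟨v, hv⟩ := exists_ne (0 : V r)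
  have := hcdef r q₁ q₂ v
  rw [h, zero_smul] at this
  simp [hv] at this

theorem tau_one_left (hs1 : s 1 = 1) (q : Q) : tau j s hs 1 q = 1 := by
  ext; simp [tau, hs1]

theorem tau_one_right (hs1 : s 1 = 1) (q : Q) : tau j s hs q 1 = 1 := by
  ext; simp [tau, hs1]

theorem cocycle_one_left [∀ r, Nontrivial (V r)] (hs1 : s 1 = 1)
    (hT1 : ∀ (r : Ghat) (v : V r), T 1 r v = castHom V (hact1 r).symm v)
    (hcdef : ∀ (r : Ghat) (q₁ q₂ : Q) (v : V r),
      T q₂ (act q₁ r) (T q₁ r v) =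
        c r q₁ q₂ • castHom V (hactmul q₁ q₂ r).symm
          (T (q₁ * q₂) r (ρ r ((tau j s hs q₁ q₂)⁻¹) v))) (r : Ghat) (q : Q) :
    c r 1 q = 1 := by
  obtain ⟨v, hv⟩ := exists_ne (0 : V r)
  have h := hcdef r 1 q v
  rw [tau_one_left hs1, inv_one, map_one, Module.End.one_apply, hT1, apply_castHom,
    apply_eq_castHom V T (one_mul q).symm, castHom_trans] at h
  have hne := castHom_ne_zero V (congrArg (act q) (hact1 r).symm)
    ((T q r).map_ne_zero_iff.mpr hv)
  exact (smul_left_injective ℂ hne (by simpa using h)).symm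

theorem cocycle_one_right [∀ r, Nontrivial (V r)] (hs1 : s 1 = 1)
    (hT1 : ∀ (r : Ghat) (v : V r), T 1 r v = castHom V (hact1 r).symm v)
    (hcdef : ∀ (r : Ghat) (q₁ q₂ : Q) (v : V r),
      T q₂ (act q₁ r) (T q₁ r v) =
        c r q₁ q₂ • castHom V (hactmul q₁ q₂ r).symm
          (T (q₁ * q₂) r (ρ r ((tau j s hs q₁ q₂)⁻¹) v))) (r : Ghat) (q : Q) :
    c r q 1 = 1 := by
  obtain ⟨v, hv⟩ := exists_ne (0 : V r)
  have h := hcdef r q 1 v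
  rw [tau_one_right hs1, inv_one, map_one, Module.End.one_apply, hT1,
    apply_eq_castHom V T (mul_one q).symm, castHom_trans] at h
  have hne := castHom_ne_zero V (hact1 (act q r)).symm
    ((T q r).map_ne_zero_iff.mpr hv)
  exact (smul_left_injective ℂ hne (by simpa using h)).symm

theorem cocycle_mul [∀ r, Nontrivial (V r)]
    (hT : ∀ (q : Q) (r : Ghat) (g : j.ker) (v : V r),
      T q r (conjRep j (ρ r) (s q) g v) = ρ (act q r) g (T q r v))
    (hcdef : ∀ (r : Ghat) (q₁ q₂ : Q) (v : V r),
      T q₂ (act q₁ r) (T q₁ r v) =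
        c r q₁ q₂ • castHom V (hactmul q₁ q₂ r).symm
          (T (q₁ * q₂) r (ρ r ((tau j s hs q₁ q₂)⁻¹) v))) (r : Ghat) (q₁ q₂ q₃ : Q) :
    c r q₁ q₂ * c r (q₁ * q₂) q₃ = c (act q₁ r) q₂ q₃ * c r q₁ (q₂ * q₃) := by
  obtain ⟨v, hv⟩ := exists_ne (0 : V r)
  have h₁ := hcdef (act q₁ r) q₂ q₃ (T q₁ r v)
  rw [← hT, hcdef r q₁ (q₂ * q₃), map_smul, castHom_trans, smul_smul,
    apply_eq_castHom V T (mul_assoc q₁ q₂ q₃), castHom_trans] at h₁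
  rw [hcdef r q₁ q₂ v, map_smul, apply_castHom, hcdef r (q₁ * q₂) q₃, map_smul, castHom_trans,
    smul_smul] at h₁
  have hvec : ρ r (tau j s hs q₁ (q₂ * q₃))⁻¹
        (conjRep j (ρ r) (s q₁) (tau j s hs q₂ q₃)⁻¹ v) =
      ρ r (tau j s hs (q₁ * q₂) q₃)⁻¹ (ρ r (tau j s hs q₁ q₂)⁻¹ v) := by
    change ρ r _ (ρ r (MulAut.conjNormal (s q₁) _) v) = _
    rw [← Module.End.mul_apply, ← Module.End.mul_apply, ← map_mul, ← map_mul]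
    congr 2
    ext
    simp [tau, mul_assoc]
  rw [hvec] at h₁
  refine smul_left_injective ℂ (castHom_ne_zero V _ ((T _ r).map_ne_zero_iff.mpr ?_)) h₁
  have hρ (g : j.ker) {w : V r} (hw : w ≠ 0) : ρ r g w ≠ 0 := fun h => hw <| by
    simpa [← Module.End.mul_apply, ← map_mul] using congrArg (ρ r g⁻¹) h
  exact hρ _ (hρ _ hv)

end Cocycle

section TwistedGroupoid

variable {Ghat Q : Type} {O : Set Ghat} {act : Q → Ghat → Ghat} {r₀ : Ghat}

theorem OrbAlg.ext {f g : OrbAlg Ghat Q O} (h : ∀ r q, f.coef r q = g.coef r q) : f = g := by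
  obtain ⟨f, _⟩ := f
  obtain ⟨g, _⟩ := g
  obtain rfl : f = g := funext fun r => funext (h r)
  rfl

theorem StabAlg.ext {f g : StabAlg Ghat Q act r₀} (h : ∀ q, f.coef q = g.coef q) : f = g := by
  obtain ⟨f, _⟩ := f
  obtain ⟨g, _⟩ := g
  obtain rfl : f = g := funext h
  rfl

open scoped Classical in
/-- The multiple `x • ([ρ], q)` of a basis element of `C(O⋊Q, c)`. -/
def OrbAlg.single (r : O) (q : Q) (x : ℂ) : OrbAlg Ghat Q O where
  coef r' q' := if r' = r ∧ q' = q then x else 0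
  supp r' hr' q' := if_neg fun h : r' = r ∧ q' = q => hr' (h.1 ▸ r.2)

open scoped Classical in
/-- The extension by zero `C(Stab([ρ₀]), c_{[ρ₀]}) → C(O⋊Q, c)`. -/
def StabAlg.toOrbAlg (hr₀ : r₀ ∈ O) (f : StabAlg Ghat Q act r₀) : OrbAlg Ghat Q O where
  coef r q := if r = r₀ then f.coef q else 0
  supp r hr _ := if_neg fun h : r = r₀ => hr (h ▸ hr₀)

open scoped Classical in
theorem moritaEquiv_orbAlg_stabAlg [Group Q] [Fintype Q] [Fintype Ghat]
    (hact1 : ∀ r, act 1 r = r)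
    (hactmul : ∀ (q₁ q₂ : Q) (r : Ghat), act q₂ (act q₁ r) = act (q₁ * q₂) r)
    (hO : O = {r | ∃ q : Q, act q r₀ = r})
    {c : Ghat → Q → Q → ℂ} (hc0 : ∀ r q₁ q₂, c r q₁ q₂ ≠ 0)
    (hc1l : ∀ r q, c r 1 q = 1) (hc1r : ∀ r q, c r q 1 = 1)
    (hc : ∀ r q₁ q₂ q₃,
      c r q₁ q₂ * c r (q₁ * q₂) q₃ = c (act q₁ r) q₂ q₃ * c r q₁ (q₂ * q₃))
    [Ring (OrbAlg Ghat Q O)] [Algebra ℂ (OrbAlg Ghat Q O)]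
    [Ring (StabAlg Ghat Q act r₀)] [Algebra ℂ (StabAlg Ghat Q act r₀)]
    (hOadd : ∀ f₁ f₂ : OrbAlg Ghat Q O,
      (f₁ + f₂).coef = fun r q => f₁.coef r q + f₂.coef r q)
    (hOsmul : ∀ (a : ℂ) (f : OrbAlg Ghat Q O), (a • f).coef = fun r q => a * f.coef r q)
    (hOmul : ∀ f₁ f₂ : OrbAlg Ghat Q O, (f₁ * f₂).coef = fun r q =>
      ∑ q₁ : Q, c r q₁ (q₁⁻¹ * q) * f₁.coef r q₁ * f₂.coef (act q₁ r) (q₁⁻¹ * q))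
    (hSadd : ∀ f₁ f₂ : StabAlg Ghat Q act r₀,
      (f₁ + f₂).coef = fun q => f₁.coef q + f₂.coef q)
    (hSsmul : ∀ (a : ℂ) (f : StabAlg Ghat Q act r₀), (a • f).coef = fun q => a * f.coef q)
    (hSmul : ∀ f₁ f₂ : StabAlg Ghat Q act r₀, (f₁ * f₂).coef = fun q =>
      ∑ q₁ : Q, c r₀ q₁ (q₁⁻¹ * q) * f₁.coef q₁ * f₂.coef (q₁⁻¹ * q)) :
    MoritaEquiv (OrbAlg Ghat Q O) (StabAlg Ghat Q act r₀) := by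
  have hr₀ : r₀ ∈ O := by rw [hO]; exact ⟨1, hact1 r₀⟩
  have hSone (q : Q) : (1 : StabAlg Ghat Q act r₀).coef q = if q = 1 then 1 else 0 := by
    let d : StabAlg Ghat Q act r₀ :=
      ⟨fun q => if q = 1 then 1 else 0, fun q hq => if_neg fun h : q = 1 => hq (h ▸ hact1 r₀)⟩
    have hd (f) : d * f = f := StabAlg.ext fun q => by simp [hSmul, d, hc1l]
    rw [← hd 1, mul_one]
  have hOone (r : Ghat) (q : Q) :
      (1 : OrbAlg Ghat Q O).coef r q = if r ∈ O ∧ q = 1 then 1 else 0 := by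
    let d : OrbAlg Ghat Q O :=
      ⟨fun r q => if r ∈ O ∧ q = 1 then 1 else 0, fun _ hr _ => if_neg fun h => hr h.1⟩
    have hd (f) : d * f = f := OrbAlg.ext fun r q => by
      by_cases hr : r ∈ O
      · simp [hOmul, d, hc1l, hr, hact1]
      · simp [OrbAlg.supp _ r hr]
    rw [← hd 1, mul_one]
  have hOzero (r : Ghat) (q : Q) : (0 : OrbAlg Ghat Q O).coef r q = 0 := by
    have := congrFun₂ (hOsmul 0 0) r q
    simpa using this
  have hOsum {ι : Type} [Fintype ι] (f : ι → OrbAlg Ghat Q O) (r : Ghat) (q : Q) :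
      (∑ i, f i).coef r q = ∑ i, (f i).coef r q :=
    map_sum (AddMonoidHom.mk' (fun g : OrbAlg Ghat Q O => g.coef r q)
      fun f₁ f₂ => congrFun₂ (hOadd f₁ f₂) r q) f Finset.univ
  have hsingle_mul (r : O) (q : Q) (x : ℂ) (f : OrbAlg Ghat Q O) (r' : Ghat) (q' : Q) :
      (OrbAlg.single r q x * f).coef r' q' =
        if r' = r then c r q (q⁻¹ * q') * x * f.coef (act q r) (q⁻¹ * q') else 0 := by
    by_cases h : r' = r
    · subst h
      simp [hOmul, OrbAlg.single]
    · simp [hOmul, OrbAlg.single, h]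
  have hsingle_mul_single (r r' : O) (q q' : Q) (x y : ℂ) (h : act q r = r') :
      OrbAlg.single r q x * OrbAlg.single r' q' y =
        OrbAlg.single r (q * q') (c r q q' * x * y) := OrbAlg.ext fun a b => by
    rw [hsingle_mul]
    by_cases ha : a = r
    · by_cases hb : b = q * q'
      · subst hb
        simp [OrbAlg.single, ha, h]
      · have : ¬ q⁻¹ * b = q' := fun h' => hb (by rw [← h', mul_inv_cancel_left])
        simp [OrbAlg.single, ha, hb, this]
    · simp [OrbAlg.single, ha]
  have hsingle_mul_single_ne (r r' : O) (q q' : Q) (x y : ℂ) (h : act q r ≠ r') :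
      OrbAlg.single r q x * OrbAlg.single r' q' y = (0 : OrbAlg Ghat Q O) :=
    OrbAlg.ext fun a b => by
      rw [hsingle_mul, hOzero]
      simp [OrbAlg.single, h]
  let φ : StabAlg Ghat Q act r₀ →ₗ[ℂ] OrbAlg Ghat Q O :=
    { toFun := StabAlg.toOrbAlg hr₀
      map_add' f g := OrbAlg.ext fun r q => by
        by_cases h : r = r₀ <;> simp [StabAlg.toOrbAlg, hOadd, hSadd, h]
      map_smul' a f := OrbAlg.ext fun r q => by
        by_cases h : r = r₀ <;> simp [StabAlg.toOrbAlg, hOsmul, hSsmul, h] }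
  have hφ (f r q) : (φ f).coef r q = if r = r₀ then f.coef q else 0 := rfl
  have hφ1 : φ 1 = OrbAlg.single ⟨r₀, hr₀⟩ 1 1 := OrbAlg.ext fun r q => by
    by_cases h : r = r₀ <;> simp [hφ, hSone, OrbAlg.single, h]
  have hφmul (f g) : φ (f * g) = φ f * φ g := OrbAlg.ext fun r q => by
    by_cases h : r = r₀
    · subst h
      simp only [hφ, if_true, hSmul, hOmul]
      refine Finset.sum_congr rfl fun q₁ _ => ?_
      by_cases hq : act q₁ r = r
      · simp [hq]
      · simp [f.supp q₁ hq]
    · simp [hφ, hOmul, h]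
  have htrans (r : O) : ∃ q, act q r₀ = r := hO.subset r.2
  choose t ht using htrans
  have ht' (r : O) : act (t r)⁻¹ r = r₀ := by
    rw [← ht, hactmul, mul_inv_cancel, hact1]
  have hnorm (r : O) : c r (t r)⁻¹ (t r) = c r₀ (t r) (t r)⁻¹ := by
    have := hc r₀ (t r) (t r)⁻¹ (t r)
    simpa [hc1l, hc1r, ht] using this.symm
  have hE : Nonempty (Matrix O O (StabAlg Ghat Q act r₀) ≃ₐ[ℂ] OrbAlg Ghat Q O) := by
    refine nonempty_matrix_algEquiv φ (fun f g h => StabAlg.ext fun q => ?_) hφmul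
      (fun a hl hr => ?_) (fun i => OrbAlg.single ⟨r₀, hr₀⟩ (t i) 1)
      (fun i => OrbAlg.single i (t i)⁻¹ (c r₀ (t i) (t i)⁻¹)⁻¹)
      (fun i k => ?_) ?_ (fun i => ?_) (fun i => ?_)
    · simpa [hφ] using congrArg (fun F => F.coef r₀ q) h
    · have hsupp (r : Ghat) (q : Q) (h : r ≠ r₀) : a.coef r q = 0 := by
        rw [← hl, hφ1, hsingle_mul, if_neg h]
      refine ⟨⟨a.coef r₀, fun q hq => ?_⟩, OrbAlg.ext fun r q => ?_⟩
      · rw [← hr, hOmul]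
        refine Finset.sum_eq_zero fun q₁ _ => ?_
        rw [hφ, hSone]
        split_ifs with h₁ h₂
        · rw [inv_mul_eq_one] at h₂
          exact absurd (h₂ ▸ h₁) hq
        all_goals simp
      · by_cases h : r = r₀
        · simp [hφ, h]
        · simp [hφ, h, hsupp r q h]
    · split_ifs with h
      · subst h
        rw [hsingle_mul_single _ _ _ _ _ _ (ht i), hφ1]
        simp [hc0]
      · exact hsingle_mul_single_ne _ _ _ _ _ _ fun h' => h (Subtype.ext ((ht i).symm.trans h'))
    · have hvu (i : O) : OrbAlg.single i (t i)⁻¹ (c r₀ (t i) (t i)⁻¹)⁻¹ *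
          OrbAlg.single ⟨r₀, hr₀⟩ (t i) 1 = OrbAlg.single i 1 1 := by
        rw [hsingle_mul_single _ _ _ _ _ _ (ht' i), hnorm]
        simp [hc0]
      refine OrbAlg.ext fun r q => ?_
      rw [hOsum, hOone]
      simp only [hvu]
      by_cases hr : r ∈ O
      · rw [Finset.sum_eq_single ⟨r, hr⟩]
        · simp [OrbAlg.single, hr]
        · intro k _ hk
          exact if_neg fun h => hk (Subtype.ext h.1.symm)
        · simp
      · simp [hr, OrbAlg.supp _ r hr]
    · rw [hφ1, hsingle_mul_single _ _ _ _ _ _ (hact1 r₀)]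
      simp [hc1l]
    · rw [hφ1, hsingle_mul_single _ _ _ _ _ _ (ht' i)]
      simp [hc1r]
  obtain ⟨E⟩ := hE
  have : Nonempty O := ⟨⟨r₀, hr₀⟩⟩
  exact ((IsMoritaEquivalent.matrix (StabAlg Ghat Q act r₀) ℂ).trans ℂ
    (IsMoritaEquivalent.of_algEquiv _ E)).symm ℂ |>.moritaEquiv

end TwistedGroupoid

/-- **Theorem 3.7.** Let `O ⊆ Ĝ` be the `Q`-orbit of `[ρ₀]`, let `C(O⋊Q, c)` be
the corresponding direct summand of `C(Ĝ⋊Q, c)` spanned by the `([ρ],q)` with `[ρ] ∈ O`, and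
let `Stab([ρ₀])` be the stabilizer of `[ρ₀]`.  Then the restriction `c_{[ρ₀]}` of `c^{[ρ₀]}`
to the stabilizer is a 2-cocycle on the group `Stab([ρ₀])`, and `C(O⋊Q, c)` is Morita
equivalent to the twisted group algebra `C(Stab([ρ₀]), c_{[ρ₀]})`. -/
theorem stmt8 {H Q : Type} [Group H] [Group Q] [Fintype H] [Fintype Q]
    (j : H →* Q) (hj : Function.Surjective j)
    (s : Q → H) (hs : ∀ q, j (s q) = q) (hs1 : s 1 = 1)
    {Ghat : Type} [Fintype Ghat]
    (V : Ghat → Type) [∀ r, AddCommGroup (V r)] [∀ r, Module ℂ (V r)]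
    [∀ r, FiniteDimensional ℂ (V r)]
    (ρ : ∀ r, Representation ℂ j.ker (V r))
    (hirr : ∀ r, IsIrredRep (ρ r))
    (hdist : ∀ r r', RepIso (ρ r) (ρ r') → r = r')
    (act : Q → Ghat → Ghat)
    (hact : ∀ q r, RepIso (conjRep j (ρ r) (s q)) (ρ (act q r)))
    (hact1 : ∀ r, act 1 r = r)
    (hactmul : ∀ (q₁ q₂ : Q) (r : Ghat), act q₂ (act q₁ r) = act (q₁ * q₂) r)
    (T : ∀ (q : Q) (r : Ghat), V r ≃ₗ[ℂ] V (act q r))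
    (hT : ∀ (q : Q) (r : Ghat) (g : j.ker) (v : V r),
      T q r (conjRep j (ρ r) (s q) g v) = ρ (act q r) g (T q r v))
    (hT1 : ∀ (r : Ghat) (v : V r), T 1 r v = castHom V (hact1 r).symm v)
    (c : Ghat → Q → Q → ℂ)
    (hcdef : ∀ (r : Ghat) (q₁ q₂ : Q) (v : V r),
      T q₂ (act q₁ r) (T q₁ r v) =
        c r q₁ q₂ • castHom V (hactmul q₁ q₂ r).symm
          (T (q₁ * q₂) r (ρ r ((tau j s hs q₁ q₂)⁻¹) v)))
    -- the orbit `O` of `[ρ₀]`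
    (r₀ : Ghat) (O : Set Ghat) (hO : O = {r | ∃ q : Q, act q r₀ = r}) :
    -- `c_{[ρ₀]}` is a 2-cocycle on the group `Stab([ρ₀])`
    (∀ q₁ q₂ q₃ : Q, q₁ ∈ stabSub act hact1 hactmul r₀ →
        q₂ ∈ stabSub act hact1 hactmul r₀ → q₃ ∈ stabSub act hact1 hactmul r₀ →
        c r₀ q₁ q₂ * c r₀ (q₁ * q₂) q₃ = c r₀ q₂ q₃ * c r₀ q₁ (q₂ * q₃)) ∧
    -- Morita equivalence of `C(O⋊Q, c)` with `C(Stab([ρ₀]), c_{[ρ₀]})`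
    (∀ (instR₁ : Ring (OrbAlg Ghat Q O)) (instA₁ : Algebra ℂ (OrbAlg Ghat Q O))
        (instR₂ : Ring (StabAlg Ghat Q act r₀)) (instA₂ : Algebra ℂ (StabAlg Ghat Q act r₀)),
      (∀ f₁ f₂ : OrbAlg Ghat Q O, (f₁ + f₂).coef = fun r q => f₁.coef r q + f₂.coef r q) →
      (∀ (a : ℂ) (f : OrbAlg Ghat Q O), (a • f).coef = fun r q => a * f.coef r q) →
      (∀ f₁ f₂ : OrbAlg Ghat Q O, (f₁ * f₂).coef = fun r q =>
        ∑ q₁ : Q, c r q₁ (q₁⁻¹ * q) * f₁.coef r q₁ * f₂.coef (act q₁ r) (q₁⁻¹ * q)) →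
      (∀ f₁ f₂ : StabAlg Ghat Q act r₀, (f₁ + f₂).coef = fun q => f₁.coef q + f₂.coef q) →
      (∀ (a : ℂ) (f : StabAlg Ghat Q act r₀), (a • f).coef = fun q => a * f.coef q) →
      (∀ f₁ f₂ : StabAlg Ghat Q act r₀, (f₁ * f₂).coef = fun q =>
        ∑ q₁ : Q, c r₀ q₁ (q₁⁻¹ * q) * f₁.coef q₁ * f₂.coef (q₁⁻¹ * q)) →
      MoritaEquiv (OrbAlg Ghat Q O) (StabAlg Ghat Q act r₀)) := by
  have (r : Ghat) : Nontrivial (V r) := (hirr r).1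
  have hc := cocycle_mul hactmul hT hcdef
  refine ⟨fun q₁ q₂ q₃ h₁ _ _ => ?_, fun _ _ _ _ hOadd hOsmul hOmul hSadd hSsmul hSmul => ?_⟩
  · rw [hc, show act q₁ r₀ = r₀ from h₁]
  · exact moritaEquiv_orbAlg_stabAlg hact1 hactmul hO (cocycle_ne_zero hactmul hcdef)
      (cocycle_one_left hact1 hactmul hs1 hT1 hcdef)
      (cocycle_one_right hact1 hactmul hs1 hT1 hcdef) hc
      hOadd hOsmul hOmul hSadd hSsmul hSmul
end
end
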